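/- Let p > 1 be an odd integer, T > 0, let S ∈ C([0,T],ℝ), and let (π_n) be the dyadic Lebesgue partitions generated by S. Assume that the measures ν^n := Σ_{[t_j,t_{j+1}] ∈ π_n} δ_{t_j} |S(t_{j+1}) − S(t_j)|^p converge weakly to a measure ν without atoms. Then for every continuous f : ℝ → ℝ and every t ∈ [0,T], lim_{n→∞} Σ_{[t_j,t_{j+1}] ∈ π_n} f(S(t_j)) (S(t_{j+1} ∧ t) − S(t_j ∧ t))^p = 0. -/

import Mathlib

open Filter Set MeasureTheory

noncomputable section

/-- The dyadic Lebesgue partition generated by `S` at level `n`: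
`τ 0 = 0`, and `τ (k+1)` is the first time after `τ k` (capped at `T`) at which `S`
reaches a dyadic level of mesh `2^{-n}` different from `S (τ k)`. -/
noncomputable def dyadicTau (S : ℝ → ℝ) (T : ℝ) (n : ℕ) : ℕ → ℝ
  | 0 => 0
  | k + 1 =>
      sInf ({u : ℝ | dyadicTau S T n k < u ∧ u ≤ T ∧
        (∃ m : ℤ, S u = (m : ℝ) / 2 ^ n) ∧ S u ≠ S (dyadicTau S T n k)} ∪ {T})

/-- The times in `(dyadicTau S T n k, T]` at which `S` takes a dyadic value other than its value
at `dyadicTau S T n k`. -/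
def dyadicHits (S : ℝ → ℝ) (T : ℝ) (n k : ℕ) : Set ℝ :=
  {u : ℝ | dyadicTau S T n k < u ∧ u ≤ T ∧
    (∃ m : ℤ, S u = (m : ℝ) / 2 ^ n) ∧ S u ≠ S (dyadicTau S T n k)}

lemma dyadicTau_succ (S : ℝ → ℝ) (T : ℝ) (n k : ℕ) :
    dyadicTau S T n (k + 1) = sInf (dyadicHits S T n k ∪ {T}) := rfl

lemma isClosed_dyadic_image (n : ℕ) (A : Set ℤ) :
    IsClosed ((fun m : ℤ => (m : ℝ) / 2 ^ n) '' A) := by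
  have h : (fun m : ℤ => (m : ℝ) / 2 ^ n) =
      (Homeomorph.mulRight₀ ((2 ^ n : ℝ)⁻¹) (by positivity)) ∘ (fun m : ℤ => (m : ℝ)) := by
    ext m
    simp [div_eq_mul_inv]
  rw [h]
  exact ((Homeomorph.isClosedEmbedding _).comp Int.isClosedEmbedding_coe_real).isClosedMap _
    (isClosed_discrete A)

lemma bddBelow_dyadicHits_union {S : ℝ → ℝ} {T : ℝ} {n k : ℕ} (h : dyadicTau S T n k ≤ T) :
    BddBelow (dyadicHits S T n k ∪ {T}) := by
  refine ⟨dyadicTau S T n k, ?_⟩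
  rintro u (hu | hu)
  · exact hu.1.le
  · rw [mem_singleton_iff.1 hu]
    exact h

lemma dyadicTau_succ_mem {S : ℝ → ℝ} {T : ℝ} {n k : ℕ} (hS : ContinuousOn S (Icc 0 T))
    (h : dyadicTau S T n k ∈ Icc 0 T) :
    dyadicTau S T n (k + 1) ∈ dyadicHits S T n k ∪ {T} := by
  rw [dyadicTau_succ]
  refine IsClosed.csInf_mem ?_ ⟨T, Or.inr rfl⟩ (bddBelow_dyadicHits_union h.2)
  refine IsClosed.union ?_ isClosed_singleton
  have heq : dyadicHits S T n k = Icc (dyadicTau S T n k) T ∩ S ⁻¹'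
      ((fun m : ℤ => (m : ℝ) / 2 ^ n) '' {m | (m : ℝ) / 2 ^ n ≠ S (dyadicTau S T n k)}) := by
    ext u
    constructor
    · rintro ⟨h1, h2, ⟨m, hm⟩, h4⟩
      exact ⟨⟨h1.le, h2⟩, m, by simpa [← hm] using h4, hm.symm⟩
    · rintro ⟨⟨h1, h2⟩, m, h3, hm⟩
      have hne : S u ≠ S (dyadicTau S T n k) := by
        rw [← hm]
        exact h3
      exact ⟨lt_of_le_of_ne h1 (fun h => hne (by rw [h])), h2, ⟨m, hm.symm⟩, hne⟩
  rw [heq]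
  exact (hS.mono (Icc_subset_Icc_left h.1)).preimage_isClosed_of_isClosed isClosed_Icc
    (isClosed_dyadic_image n _)

lemma dyadicTau_mem {S : ℝ → ℝ} {T : ℝ} (hT : 0 ≤ T) (hS : ContinuousOn S (Icc 0 T)) (n k : ℕ) :
    dyadicTau S T n k ∈ Icc 0 T := by
  induction k with
  | zero => exact ⟨le_rfl, hT⟩
  | succ k ih =>
    rcases dyadicTau_succ_mem hS ih with h | h
    · exact ⟨ih.1.trans h.1.le, h.2.1⟩
    · rw [mem_singleton_iff.1 h]
      exact ⟨hT, le_rfl⟩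

lemma dyadicTau_monotone {S : ℝ → ℝ} {T : ℝ} (hT : 0 ≤ T) (hS : ContinuousOn S (Icc 0 T))
    (n : ℕ) : Monotone (dyadicTau S T n) := by
  refine monotone_nat_of_le_succ fun k => ?_
  rcases dyadicTau_succ_mem hS (dyadicTau_mem hT hS n k) with h | h
  · exact h.1.le
  · rw [mem_singleton_iff.1 h]
    exact (dyadicTau_mem hT hS n k).2

lemma dyadicTau_succ_mem_hits {S : ℝ → ℝ} {T : ℝ} (hT : 0 ≤ T) (hS : ContinuousOn S (Icc 0 T))
    {n k : ℕ} (h : dyadicTau S T n (k + 1) < T) :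
    dyadicTau S T n (k + 1) ∈ dyadicHits S T n k :=
  (dyadicTau_succ_mem hS (dyadicTau_mem hT hS n k)).resolve_right h.ne

/-- Between two consecutive partition times, `S` moves by at most one mesh. -/
lemma abs_sub_dyadicTau_le {S : ℝ → ℝ} {T : ℝ} (hT : 0 ≤ T) (hS : ContinuousOn S (Icc 0 T))
    {n k : ℕ} {u : ℝ} (h1 : dyadicTau S T n k ≤ u) (h2 : u ≤ dyadicTau S T n (k + 1)) :
    |S u - S (dyadicTau S T n k)| ≤ (1 / 2) ^ n := by
  have hk := dyadicTau_mem hT hS n k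
  have huT : u ≤ T := h2.trans (dyadicTau_mem hT hS n (k + 1)).2
  have hSu : ContinuousOn S (uIcc (dyadicTau S T n k) u) := by
    rw [uIcc_of_le h1]
    exact hS.mono (Icc_subset_Icc hk.1 huT)
  have hpow : (0 : ℝ) < 2 ^ n := by positivity
  have key : ∀ m : ℤ, (m : ℝ) / 2 ^ n ∈ uIcc (S (dyadicTau S T n k)) (S u) →
      (m : ℝ) / 2 ^ n ≠ S (dyadicTau S T n k) → (m : ℝ) / 2 ^ n ≠ S u → False := by
    intro m hm hne hne'
    obtain ⟨v, hv, hvm⟩ := intermediate_value_uIcc hSu hm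
    rw [uIcc_of_le h1] at hv
    have hlt : dyadicTau S T n k < v :=
      lt_of_le_of_ne hv.1 (fun h => hne (by rw [h, hvm]))
    have hvu : v < u := lt_of_le_of_ne hv.2 (fun h => hne' (by rw [← h, hvm]))
    have : dyadicTau S T n (k + 1) ≤ v :=
      csInf_le (bddBelow_dyadicHits_union hk.2)
        (Or.inl ⟨hlt, hv.2.trans huT, ⟨m, hvm⟩, by rw [hvm]; exact hne⟩)
    linarith
  by_contra! hcon
  rw [one_div, inv_pow, ← one_div] at hcon
  set a := S (dyadicTau S T n k)
  rcases lt_abs.1 hcon with h | h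
  · have f1 := Int.lt_floor_add_one (a * 2 ^ n)
    have f2 := Int.floor_le (a * 2 ^ n)
    have e1 : a < ((⌊a * 2 ^ n⌋ + 1 : ℤ) : ℝ) / 2 ^ n := by
      rw [lt_div_iff₀ hpow]
      push_cast
      exact f1
    have e2 : ((⌊a * 2 ^ n⌋ + 1 : ℤ) : ℝ) / 2 ^ n ≤ a + 1 / 2 ^ n := by
      rw [div_le_iff₀ hpow, add_mul, one_div, inv_mul_cancel₀ hpow.ne']
      push_cast
      linarith
    exact key _ (mem_uIcc.2 (Or.inl ⟨e1.le, by linarith⟩)) e1.ne' (by linarith : _ < S u).ne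
  · have f1 := Int.ceil_lt_add_one (a * 2 ^ n)
    have f2 := Int.le_ceil (a * 2 ^ n)
    have e1 : ((⌈a * 2 ^ n⌉ - 1 : ℤ) : ℝ) / 2 ^ n < a := by
      rw [div_lt_iff₀ hpow]
      push_cast
      linarith
    have e2 : a - 1 / 2 ^ n ≤ ((⌈a * 2 ^ n⌉ - 1 : ℤ) : ℝ) / 2 ^ n := by
      rw [le_div_iff₀ hpow, sub_mul, one_div, inv_mul_cancel₀ hpow.ne']
      push_cast
      linarith
    exact key _ (mem_uIcc.2 (Or.inr ⟨by linarith, e1.le⟩)) e1.ne (ne_of_gt (by linarith : S u < _))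

/-- Away from the first step and before reaching `T`, each step of `S` is exactly one mesh. -/
lemma abs_dyadicTau_step_eq {S : ℝ → ℝ} {T : ℝ} (hT : 0 ≤ T) (hS : ContinuousOn S (Icc 0 T))
    {n k : ℕ} (h : dyadicTau S T n (k + 2) < T) :
    |S (dyadicTau S T n (k + 2)) - S (dyadicTau S T n (k + 1))| = (1 / 2) ^ n := by
  have hmono := dyadicTau_monotone hT hS n
  refine le_antisymm (abs_sub_dyadicTau_le hT hS (hmono (Nat.le_succ _)) le_rfl) ?_
  obtain ⟨-, -, ⟨m, hm⟩, hne⟩ := dyadicTau_succ_mem_hits hT hS h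
  obtain ⟨-, -, ⟨m', hm'⟩, -⟩ :=
    dyadicTau_succ_mem_hits hT hS ((hmono (Nat.le_succ (k + 1))).trans_lt h)
  rw [hm, hm'] at hne ⊢
  have hmm : m - m' ≠ 0 := fun h0 => hne (by rw [sub_eq_zero.1 h0])
  have h1 : (1 : ℝ) ≤ |(m : ℝ) - m'| := by exact_mod_cast Int.one_le_abs hmm
  rw [← sub_div, abs_div, abs_of_pos (by positivity : (0 : ℝ) < 2 ^ n), one_div, inv_pow,
    ← one_div]
  gcongr

lemma exists_dyadicTau_eq {S : ℝ → ℝ} {T : ℝ} (hT : 0 ≤ T) (hS : ContinuousOn S (Icc 0 T))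
    (n : ℕ) : ∃ k, dyadicTau S T n k = T := by
  by_contra! hcon
  have hmem := dyadicTau_mem hT hS n
  have hlt : ∀ k, dyadicTau S T n k < T := fun k => lt_of_le_of_ne (hmem k).2 (hcon k)
  have hlim := tendsto_atTop_ciSup (dyadicTau_monotone hT hS n)
    ⟨T, by rintro _ ⟨k, rfl⟩; exact (hmem k).2⟩
  have hL := isClosed_Icc.mem_of_tendsto hlim (Eventually.of_forall hmem)
  have hSlim : Tendsto (fun k => S (dyadicTau S T n k)) atTop
      (nhds (S (⨆ k, dyadicTau S T n k))) :=
    (hS _ hL).tendsto.comp (tendsto_nhdsWithin_iff.2 ⟨hlim, Eventually.of_forall hmem⟩)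
  have hd := ((hSlim.comp (tendsto_add_atTop_nat 2)).sub
    (hSlim.comp (tendsto_add_atTop_nat 1))).abs
  have hc : Tendsto (fun _ : ℕ => ((1 : ℝ) / 2) ^ n) atTop (nhds 0) := by
    have : Tendsto (fun k : ℕ => |S (dyadicTau S T n (k + 2)) - S (dyadicTau S T n (k + 1))|)
        atTop (nhds 0) := by simpa using hd
    refine this.congr fun k => abs_dyadicTau_step_eq hT hS (hlt _)
  have := tendsto_nhds_unique hc tendsto_const_nhds
  have : (0 : ℝ) < (1 / 2) ^ n := by positivity
  linarith

lemma summable_dyadicTau_abs_pow {S : ℝ → ℝ} {T : ℝ} (hT : 0 ≤ T)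
    (hS : ContinuousOn S (Icc 0 T)) (n : ℕ) {p : ℕ} (hp : p ≠ 0) :
    Summable fun j => |S (dyadicTau S T n (j + 1)) - S (dyadicTau S T n j)| ^ p := by
  obtain ⟨K, hK⟩ := exists_dyadicTau_eq hT hS n
  have hT' : ∀ j, K ≤ j → dyadicTau S T n j = T := fun j hj =>
    le_antisymm (dyadicTau_mem hT hS n j).2 (hK.ge.trans (dyadicTau_monotone hT hS n hj))
  refine summable_of_ne_finset_zero (s := Finset.range K) fun j hj => ?_
  have hj : K ≤ j := by simpa using hj
  rw [hT' j hj, hT' (j + 1) (by omega)]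
  simp [hp]

/-- The sum stopped at `t` consists of full steps and one last step ending at `t`. -/
lemma exists_tsum_stopped_eq {S : ℝ → ℝ} {T : ℝ} (hT : 0 ≤ T) (hS : ContinuousOn S (Icc 0 T))
    (f : ℝ → ℝ) {t : ℝ} (ht : t ∈ Icc 0 T) (n : ℕ) {p : ℕ} (hp : p ≠ 0) :
    ∃ k, (∀ j < k, dyadicTau S T n (j + 1) < t) ∧
      dyadicTau S T n k ≤ t ∧ t ≤ dyadicTau S T n (k + 1) ∧
      ∑' j : ℕ, f (S (dyadicTau S T n j)) *
        (S (min (dyadicTau S T n (j + 1)) t) - S (min (dyadicTau S T n j) t)) ^ p =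
      ∑ j ∈ Finset.range k, f (S (dyadicTau S T n j)) *
        (S (dyadicTau S T n (j + 1)) - S (dyadicTau S T n j)) ^ p +
      f (S (dyadicTau S T n k)) * (S t - S (dyadicTau S T n k)) ^ p := by
  classical
  have hmono := dyadicTau_monotone hT hS n
  have hex : ∃ k, t ≤ dyadicTau S T n (k + 1) := by
    obtain ⟨K, hK⟩ := exists_dyadicTau_eq hT hS n
    exact ⟨K, ht.2.trans (hK.ge.trans (hmono (Nat.le_succ K)))⟩
  obtain ⟨k, hk, hmin⟩ : ∃ k, t ≤ dyadicTau S T n (k + 1) ∧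
      ∀ j < k, dyadicTau S T n (j + 1) < t :=
    ⟨Nat.find hex, Nat.find_spec hex, fun j hj => not_le.1 (Nat.find_min hex hj)⟩
  have hkt : dyadicTau S T n k ≤ t := by
    cases k with
    | zero => exact ht.1
    | succ k => exact (hmin k (Nat.lt_succ_self k)).le
  refine ⟨k, hmin, hkt, hk, ?_⟩
  rw [tsum_eq_sum (s := Finset.range (k + 1)), Finset.sum_range_succ, min_eq_right hk,
    min_eq_left hkt]
  · congr 1
    refine Finset.sum_congr rfl fun j hj => ?_
    have hj := hmin j (Finset.mem_range.1 hj)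
    rw [min_eq_left hj.le, min_eq_left ((hmono (Nat.le_succ j)).trans hj.le)]
  · intro j hj
    have hj : k + 1 ≤ j := by simpa using hj
    rw [min_eq_right (hk.trans (hmono hj)), min_eq_right (hk.trans (hmono (hj.trans j.le_succ)))]
    simp [hp]

/-- For an odd power, `f a * (b - a) ^ p` is close to a multiple of the integral of `f` over
`[a, b]`. -/
lemma abs_mul_pow_sub_integral_le {f : ℝ → ℝ} (hf : Continuous f) {p : ℕ} (hp : Odd p)
    {a b w : ℝ} (hw : ∀ x ∈ uIcc a b, |f a - f x| ≤ w) :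
    |f a * (b - a) ^ p - |b - a| ^ (p - 1) * ∫ x in a..b, f x| ≤ w * |b - a| ^ p := by
  obtain ⟨q, rfl⟩ := hp
  have he : (b - a) ^ (2 * q) = |b - a| ^ (2 * q) := by rw [pow_mul, pow_mul, sq_abs]
  have hint : ∫ x in a..b, (f a - f x) = (b - a) * f a - ∫ x in a..b, f x := by
    rw [intervalIntegral.integral_sub (by simp) (hf.intervalIntegrable a b)]
    simp
  have hb : |∫ x in a..b, (f a - f x)| ≤ w * |b - a| := by
    rw [← Real.norm_eq_abs]
    exact intervalIntegral.norm_integral_le_of_norm_le_const fun x hx =>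
      hw x (uIoc_subset_uIcc hx)
  have hrw : f a * (b - a) ^ (2 * q + 1) - |b - a| ^ (2 * q + 1 - 1) * ∫ x in a..b, f x =
      |b - a| ^ (2 * q) * ∫ x in a..b, (f a - f x) := by
    rw [hint, pow_succ, he, Nat.add_sub_cancel]
    ring
  rw [hrw, abs_mul, abs_of_nonneg (by positivity : 0 ≤ |b - a| ^ (2 * q)), pow_succ]
  calc |b - a| ^ (2 * q) * |∫ x in a..b, (f a - f x)|
      ≤ |b - a| ^ (2 * q) * (w * |b - a|) := by gcongr
    _ = w * (|b - a| ^ (2 * q) * |b - a|) := by ring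

/-- Quantitative estimate of the signed sum stopped at `t`. Here `w` is a modulus of continuity of
`f` at scale `2 ^ (-n)`, and `M` bounds `f`, on an interval containing the range of `S`. -/
lemma abs_tsum_stopped_le {S : ℝ → ℝ} {T : ℝ} (hT : 0 ≤ T) (hS : ContinuousOn S (Icc 0 T))
    {f : ℝ → ℝ} (hf : Continuous f) {t : ℝ} (ht : t ∈ Icc 0 T) {n p : ℕ} (hp : Odd p)
    (hp1 : 1 < p) {K M w : ℝ} (hK : ∀ u ∈ Icc 0 T, |S u| ≤ K)
    (hM : ∀ x ∈ Icc (-K) K, |f x| ≤ M) (hw0 : 0 ≤ w)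
    (hw : ∀ x ∈ Icc (-K) K, ∀ y ∈ Icc (-K) K, |x - y| ≤ (1 / 2) ^ n → |f x - f y| ≤ w) :
    |∑' j : ℕ, f (S (dyadicTau S T n j)) *
        (S (min (dyadicTau S T n (j + 1)) t) - S (min (dyadicTau S T n j) t)) ^ p| ≤
      w * ∑' j : ℕ, |S (dyadicTau S T n (j + 1)) - S (dyadicTau S T n j)| ^ p +
        (3 * M + 2 * K * M) * (1 / 2) ^ n := by
  obtain ⟨k, hlt, hkt, htk, hsum⟩ := exists_tsum_stopped_eq hT hS f ht n (by omega : p ≠ 0)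
  rw [hsum]
  clear hsum
  have hmono := dyadicTau_monotone hT hS n
  have hmem := dyadicTau_mem hT hS n
  have hsm := (summable_dyadicTau_abs_pow hT hS n (by omega : p ≠ 0)).sum_le_tsum
    (Finset.range k) (fun j _ => by positivity)
  have hlast := abs_sub_dyadicTau_le hT hS hkt htk
  have hstep : ∀ j, |S (dyadicTau S T n (j + 1)) - S (dyadicTau S T n j)| ≤ (1 / 2) ^ n :=
    fun j => abs_sub_dyadicTau_le hT hS (hmono j.le_succ) le_rfl
  have hfull : ∀ j, j + 1 < k →
      |S (dyadicTau S T n (j + 2)) - S (dyadicTau S T n (j + 1))| = (1 / 2) ^ n :=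
    fun j hj => abs_dyadicTau_step_eq hT hS ((hlt _ hj).trans_le ht.2)
  have hR : ∀ j, S (dyadicTau S T n j) ∈ Icc (-K) K := fun j => abs_le.1 (hK _ (hmem j))
  set h : ℝ := (1 / 2) ^ n
  set s : ℕ → ℝ := fun j => S (dyadicTau S T n j)
  have h0 : 0 < h := by positivity
  have h1 : h ≤ 1 := pow_le_one₀ (by norm_num) (by norm_num)
  have hM0 : 0 ≤ M := (abs_nonneg _).trans (hM _ (hR 0))
  have hhp : h ^ p ≤ h := pow_le_of_le_one h0.le h1 (by omega)
  have hhp' : h ^ (p - 1) ≤ h := pow_le_of_le_one h0.le h1 (by omega)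
  have hsub : ∀ i j, uIcc (s i) (s j) ⊆ Icc (-K) K := fun i j =>
    ordConnected_Icc.uIcc_subset (hR i) (hR j)
  have hI : ∀ i j, |∫ x in (s i)..(s j), f x| ≤ M * |s j - s i| := by
    intro i j
    rw [← Real.norm_eq_abs]
    exact intervalIntegral.norm_integral_le_of_norm_le_const fun x hx =>
      hM x (hsub i j (uIoc_subset_uIcc hx))
  have hone : ∀ j ∈ Finset.range k,
      |f (s j) * (s (j + 1) - s j) ^ p - h ^ (p - 1) * ∫ x in (s j)..(s (j + 1)), f x| ≤
        w * |s (j + 1) - s j| ^ p + if j = 0 then 2 * M * h else 0 := by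
    intro j hj
    rcases j with _ | j
    · have hs01 := hstep 0
      rw [if_pos rfl]
      have e1 : |f (s 0) * (s (0 + 1) - s 0) ^ p| ≤ M * h := by
        rw [abs_mul, abs_pow]
        have : |s (0 + 1) - s 0| ^ p ≤ h := (pow_le_pow_left₀ (abs_nonneg _) hs01 p).trans hhp
        exact mul_le_mul (hM _ (hR 0)) this (by positivity) hM0
      have e2 : |h ^ (p - 1) * ∫ x in (s 0)..(s (0 + 1)), f x| ≤ M * h := by
        rw [abs_mul, abs_of_nonneg (by positivity : 0 ≤ h ^ (p - 1))]
        have : |∫ x in (s 0)..(s (0 + 1)), f x| ≤ M * 1 :=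
          (hI 0 1).trans (mul_le_mul_of_nonneg_left (hs01.trans h1) hM0)
        calc _ ≤ h * (M * 1) := mul_le_mul hhp' this (abs_nonneg _) h0.le
          _ = M * h := by ring
      have e3 : 0 ≤ w * |s (0 + 1) - s 0| ^ p := by positivity
      have e4 := abs_sub (f (s 0) * (s (0 + 1) - s 0) ^ p)
        (h ^ (p - 1) * ∫ x in (s 0)..(s (0 + 1)), f x)
      linarith
    · have hf1 : |s (j + 1 + 1) - s (j + 1)| = h := hfull j (Finset.mem_range.1 hj)
      rw [if_neg (Nat.succ_ne_zero j), add_zero]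
      have := abs_mul_pow_sub_integral_le hf hp (a := s (j + 1)) (b := s (j + 1 + 1)) (w := w)
        fun x hx => hw _ (hR _) _ (hsub _ _ hx) (by
          rw [abs_sub_comm, ← hf1]
          exact abs_sub_left_of_mem_uIcc hx)
      rwa [hf1] at this ⊢
  have htel : ∑ j ∈ Finset.range k, ∫ x in (s j)..(s (j + 1)), f x = ∫ x in (s 0)..(s k), f x :=
    intervalIntegral.sum_integral_adjacent_intervals fun j _ => hf.intervalIntegrable _ _
  have hA : |∑ j ∈ Finset.range k, f (s j) * (s (j + 1) - s j) ^ p -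
      h ^ (p - 1) * ∫ x in (s 0)..(s k), f x| ≤
        w * ∑ j ∈ Finset.range k, |s (j + 1) - s j| ^ p + 2 * M * h := by
    rw [← htel, Finset.mul_sum, ← Finset.sum_sub_distrib]
    refine (Finset.abs_sum_le_sum_abs _ _).trans ((Finset.sum_le_sum hone).trans ?_)
    rw [Finset.sum_add_distrib, ← Finset.mul_sum, Finset.sum_ite_eq']
    gcongr
    split_ifs
    · exact le_rfl
    · positivity
  have hB : |h ^ (p - 1) * ∫ x in (s 0)..(s k), f x| ≤ 2 * K * M * h := by
    rw [abs_mul, abs_of_nonneg (by positivity : 0 ≤ h ^ (p - 1))]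
    have hd : |s k - s 0| ≤ 2 * K :=
      abs_le.2 ⟨by linarith [(hR k).1, (hR 0).2], by linarith [(hR k).2, (hR 0).1]⟩
    have : |∫ x in (s 0)..(s k), f x| ≤ M * (2 * K) :=
      (hI 0 k).trans (mul_le_mul_of_nonneg_left hd hM0)
    calc _ ≤ h * (M * (2 * K)) := mul_le_mul hhp' this (abs_nonneg _) h0.le
      _ = 2 * K * M * h := by ring
  have hC : |f (s k) * (S t - s k) ^ p| ≤ M * h := by
    rw [abs_mul, abs_pow]
    exact mul_le_mul (hM _ (hR k)) ((pow_le_pow_left₀ (abs_nonneg _) hlast p).trans hhp)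
      (by positivity) hM0
  have hD := mul_le_mul_of_nonneg_left hsm hw0
  rw [abs_le] at hA hB hC ⊢
  constructor <;> linarith [hA.1, hA.2, hB.1, hB.2, hC.1, hC.2]

/-- For odd `p > 1`, if along the dyadic Lebesgue partitions generated
by `S` the measures `ν^n = ∑ δ_{t_j} |S(t_{j+1}) - S(t_j)|^p` converge weakly to an
atomless measure `ν`, then for every continuous `f` and every `t ∈ [0,T]` the signed sums
`∑ f(S(t_j)) (S(t_{j+1}∧t) - S(t_j∧t))^p` converge to `0`. -/
theorem stmt_14 (p : ℕ) (hp : Odd p) (hp1 : 1 < p) (T : ℝ) (hT : 0 < T)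
    (S : ℝ → ℝ) (hS : ContinuousOn S (Icc 0 T))
    (ν : Measure ℝ) (hfin : IsFiniteMeasure ν) (hatom : ∀ x : ℝ, ν {x} = 0)
    (hconv : ∀ g : ℝ → ℝ, Continuous g →
      Tendsto (fun n => ∑' j : ℕ,
          g (dyadicTau S T n j) *
            |S (dyadicTau S T n (j + 1)) - S (dyadicTau S T n j)| ^ p)
        atTop (nhds (∫ x, g x ∂ν))) :
    ∀ f : ℝ → ℝ, Continuous f → ∀ t ∈ Icc (0 : ℝ) T,
      Tendsto (fun n => ∑' j : ℕ,
          f (S (dyadicTau S T n j)) *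
            (S (min (dyadicTau S T n (j + 1)) t) - S (min (dyadicTau S T n j) t)) ^ p)
        atTop (nhds 0) := by
  intro f hf t ht
  have hT' := hT.le
  obtain ⟨K, hK⟩ := isCompact_Icc.exists_bound_of_continuousOn hS
  obtain ⟨M, hM⟩ := (isCompact_Icc (a := -K) (b := K)).exists_bound_of_continuousOn hf.continuousOn
  have huc := (isCompact_Icc (a := -K) (b := K)).uniformContinuousOn_of_continuous
    hf.continuousOn
  rw [Metric.uniformContinuousOn_iff] at huc
  have hc := hconv (fun _ => 1) continuous_const
  simp only [one_mul] at hc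
  set C := ∫ _, (1 : ℝ) ∂ν
  have hC0 : 0 ≤ C := integral_nonneg fun _ => zero_le_one
  have hpow : Tendsto (fun n : ℕ => ((1 : ℝ) / 2) ^ n) atTop (nhds 0) :=
    tendsto_pow_atTop_nhds_zero_of_lt_one (by norm_num) (by norm_num)
  rw [Metric.tendsto_nhds]
  intro ε hε
  set w := ε / (2 * (C + 1)) with hw
  have hw0 : 0 < w := by positivity
  obtain ⟨δ, hδ, hfδ⟩ := huc w hw0
  have hlin : Tendsto (fun n : ℕ => (3 * M + 2 * K * M) * ((1 : ℝ) / 2) ^ n) atTop (nhds 0) := by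
    simpa using hpow.const_mul (3 * M + 2 * K * M)
  filter_upwards [hpow.eventually_lt_const hδ, hc.eventually_lt_const (lt_add_one C),
    hlin.eventually_lt_const (half_pos hε)] with n hn1 hn2 hn3
  rw [Real.dist_eq, sub_zero]
  refine (abs_tsum_stopped_le hT' hS hf ht hp hp1 hK hM hw0.le
    fun x hx y hy hxy => (hfδ x hx y hy (hxy.trans_lt hn1)).le).trans_lt ?_
  have h1 := mul_le_mul_of_nonneg_left hn2.le hw0.le
  have h2 : w * (C + 1) = ε / 2 := by
    rw [hw]
    field_simp
  linarith

end
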